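/- Let M be a unital C*-algebra with a tracial state τ, let D be a C*-subalgebra of M containing the unit, let A be a unital subalgebra of M containing D, and let Φ : A → D be a unital algebra homomorphism with Φ(d) = d for all d ∈ D and τ(Φ(a)) = τ(a) for all a ∈ A. If x ∈ A is such that Φ(x) is invertible in D and ‖Φ(x)^{-1} x − 1‖ ≤ 1, then Δ_τ(Φ(x)) = Δ_τ(x). -/

import Mathlib

open scoped ComplexOrder

/-- The absolute value `|a| = (a*a)^{1/2}` in a C*-algebra. -/
noncomputable def cstarAbs {M : Type*} [CStarAlgebra M] [PartialOrder M] [StarOrderedRing M]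
    (a : M) : M :=
  CFC.sqrt (star a * a)

/-- The Fuglede–Kadison determinant associated to a tracial state `τ`:
`Δ_τ(a) = inf_{ε>0} exp(τ(log(|a| + ε·1)))`. -/
noncomputable def fkDet {M : Type*} [CStarAlgebra M] [PartialOrder M] [StarOrderedRing M]
    (τ : M →ₗ[ℂ] ℂ) (a : M) : ℝ :=
  ⨅ ε : {ε : ℝ // 0 < ε}, Real.exp ((τ (CFC.log (cstarAbs a + (ε : ℝ) • 1))).re)

open Filter Topology

section FugledeKadison

variable {M : Type*} [CStarAlgebra M]

/-- The Mercator series for the logarithm in a C*-algebra. -/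
theorem CFC.hasSum_log_one_sub {h : M} (hsa : IsSelfAdjoint h) (hh : ‖h‖ < 1) :
    HasSum (fun n : ℕ => ((n + 1 : ℝ)⁻¹) • h ^ (n + 1)) (-CFC.log (1 - h)) := by
  have hspec : ∀ x ∈ spectrum ℝ h, |x| ≤ ‖h‖ := fun x hx => by
    have : Nontrivial M := by
      by_contra hM
      rw [not_nontrivial_iff_subsingleton] at hM
      simp at hx
    simpa using spectrum.norm_le_norm_of_mem hx
  have hcont : ContinuousOn (fun x : ℝ => Real.log (1 - x)) (spectrum ℝ h) := by
    refine ContinuousOn.log (by fun_prop) fun x hx => ?_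
    have := abs_le.1 (hspec x hx)
    linarith
  have hlog : -CFC.log (1 - h) = cfc (fun x : ℝ => -Real.log (1 - x)) h := by
    rw [cfc_neg, CFC.log]
    congr 1
    have h1 : (1 - h) = cfc (fun x : ℝ => 1 - x) h := by
      rw [cfc_sub (fun _ => (1 : ℝ)) (fun x => x) h, cfc_const_one ℝ h, cfc_id' ℝ h]
    rw [h1, ← cfc_comp' Real.log (fun x : ℝ => 1 - x) h ?_]
    refine ContinuousOn.log continuousOn_id ?_
    rintro _ ⟨x, hx, rfl⟩
    have := abs_le.1 (hspec x hx)
    change 1 - x ≠ 0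
    linarith
  have hsum : Summable (fun n : ℕ => ((n + 1 : ℝ)⁻¹) • h ^ (n + 1)) := by
    refine Summable.of_norm_bounded
      ((summable_nat_add_iff 1).2 (summable_geometric_of_lt_one (norm_nonneg h) hh)) fun n => ?_
    rw [norm_smul, Real.norm_of_nonneg (by positivity)]
    calc (n + 1 : ℝ)⁻¹ * ‖h ^ (n + 1)‖ ≤ 1 * ‖h‖ ^ (n + 1) := by
          gcongr
          · exact inv_le_one_of_one_le₀ (by linarith [n.cast_nonneg (α := ℝ)])
          · exact norm_pow_le' _ n.succ_pos
      _ = _ := one_mul _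
  rw [hsum.hasSum_iff_tendsto_nat, hlog]
  have hpart : ∀ n : ℕ, ∑ i ∈ Finset.range n, ((i + 1 : ℝ)⁻¹) • h ^ (i + 1) =
      cfc (fun x : ℝ => ∑ i ∈ Finset.range n, x ^ (i + 1) / (i + 1)) h := fun n => by
    rw [show (fun x : ℝ => ∑ i ∈ Finset.range n, x ^ (i + 1) / (i + 1)) =
      ∑ i ∈ Finset.range n, fun x : ℝ => (i + 1 : ℝ)⁻¹ • x ^ (i + 1) by
        ext x; simp [div_eq_inv_mul]]
    rw [cfc_sum _ h _ (fun i _ => by fun_prop)]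
    refine Finset.sum_congr rfl fun i _ => ?_
    rw [cfc_smul _ _ h (by fun_prop), cfc_pow_id h]
  simp_rw [hpart]
  refine tendsto_cfc_fun ?_ (.of_forall fun n => by fun_prop)
  rw [Metric.tendstoUniformlyOn_iff]
  intro ε hε
  have hlim : Tendsto (fun n : ℕ => ‖h‖ ^ (n + 1) / (1 - ‖h‖)) atTop (𝓝 0) := by
    simpa using ((tendsto_pow_atTop_nhds_zero_of_lt_one (norm_nonneg h) hh).comp
      (tendsto_add_atTop_nat 1)).div_const (1 - ‖h‖)
  filter_upwards [hlim.eventually (gt_mem_nhds hε)] with n hn x hx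
  have hx' := hspec x hx
  rw [dist_comm, Real.dist_eq, sub_neg_eq_add]
  refine (Real.abs_log_sub_add_sum_range_le (hx'.trans_lt hh) n).trans_lt (lt_of_le_of_lt ?_ hn)
  have : 0 < 1 - ‖h‖ := by linarith
  gcongr

theorem exists_inverse_one_add_smul (τ : M →L[ℂ] ℂ) {w : M} (hw : ‖w‖ ≤ 1)
    (hτw : ∀ n : ℕ, τ (w ^ (n + 1)) = 0) {s : ℝ} (hs : |s| < 1) :
    ∃ v : M, v * (1 + s • w) = 1 ∧ (1 + s • w) * v = 1 ∧ τ (v * w) = 0 := by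
  have hn : ‖-(s • w)‖ < 1 := by
    rw [norm_neg, norm_smul, Real.norm_eq_abs]
    nlinarith [abs_nonneg s, norm_nonneg w]
  refine ⟨∑' n : ℕ, (-(s • w)) ^ n, ?_, ?_, ?_⟩
  · simpa using geom_series_mul_neg _ hn
  · simpa using mul_neg_geom_series _ hn
  · have h := ((summable_geometric_of_norm_lt_one hn).hasSum.mul_right w).mapL τ
    rw [← h.tsum_eq]
    refine (tsum_congr fun n => ?_).trans tsum_zero
    rw [← neg_smul, smul_pow, smul_mul_assoc, ← pow_succ, ← Complex.coe_smul, map_smul, hτw,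
      smul_zero]

variable [PartialOrder M] [StarOrderedRing M]

theorem IsStrictlyPositive.norm_one_sub_inv_smul_lt {b : M} (hb : IsStrictlyPositive b) {K : ℝ}
    (hK : 0 < K) (hbK : ‖b‖ ≤ K) : ‖1 - K⁻¹ • b‖ < 1 := by
  nontriviality M
  obtain ⟨m, hm, hmb⟩ := (CFC.exists_pos_algebraMap_le_iff hb.isSelfAdjoint).2
    fun x hx => hb.spectrum_pos hx
  have hle : b ≤ algebraMap ℝ M K :=
    (CStarAlgebra.norm_le_iff_le_algebraMap b hK.le hb.nonneg).1 hbK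
  have hmK : m ≤ K := by
    have := CStarAlgebra.norm_le_norm_of_nonneg_of_le
      (by simpa using (isStrictlyPositive_algebraMap hm (A := M)).nonneg) hmb
    rw [norm_algebraMap', Real.norm_of_nonneg hm.le] at this
    exact this.trans hbK
  have h0 : 0 ≤ 1 - K⁻¹ • b := by
    have := smul_le_smul_of_nonneg_left hle (inv_nonneg.2 hK.le)
    rw [Algebra.algebraMap_eq_smul_one, smul_smul, inv_mul_cancel₀ hK.ne', one_smul] at this
    exact sub_nonneg.2 this
  have h1 : 1 - K⁻¹ • b ≤ algebraMap ℝ M (1 - K⁻¹ * m) := by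
    have := smul_le_smul_of_nonneg_left hmb (inv_nonneg.2 hK.le)
    rw [Algebra.algebraMap_eq_smul_one, smul_smul] at this
    rw [map_sub, map_one, Algebra.algebraMap_eq_smul_one]
    exact sub_le_sub_left this 1
  have h2 : 0 ≤ 1 - K⁻¹ * m := by
    rw [inv_mul_eq_div, sub_nonneg]
    exact (div_le_one hK).2 hmK
  refine ((CStarAlgebra.norm_le_iff_le_algebraMap _ h2 h0).2 h1).trans_lt ?_
  have : 0 < K⁻¹ * m := by positivity
  linarith

theorem IsStrictlyPositive.hasSum_log {b : M} (hb : IsStrictlyPositive b) {K : ℝ}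
    (hK : 0 < K) (hbK : ‖1 - K⁻¹ • b‖ < 1) :
    HasSum (fun n : ℕ => -((n + 1 : ℝ)⁻¹ • (1 - K⁻¹ • b) ^ (n + 1)))
      (CFC.log b - algebraMap ℝ M (Real.log K)) := by
  have hsa : IsSelfAdjoint (1 - K⁻¹ • b) :=
    (IsSelfAdjoint.one M).sub ((IsSelfAdjoint.all _).smul hb.isSelfAdjoint)
  have := (CFC.hasSum_log_one_sub hsa hbK).neg
  rw [neg_neg, sub_sub_cancel, CFC.log_smul' b (inv_pos.2 hK) hb, Real.log_inv, map_neg,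
    neg_add_eq_sub] at this
  exact this

/-- Derivative of the trace of the logarithm along a `C¹` path, on a neighbourhood where the
Mercator series converges. -/
theorem hasDerivAt_re_trace_log [Nontrivial M] (τ : M →L[ℂ] ℂ) (hτtr : ∀ a b : M, τ (a * b) = τ (b * a))
    {b b' : ℝ → M} (hb : ∀ s, HasDerivAt b (b' s) s) (hb' : Continuous b') {s : ℝ}
    (hpos : ∀ᶠ r in 𝓝 s, IsStrictlyPositive (b r)) {c : M} (hc : c * b s = 1) :
    HasDerivAt (fun r => (τ (CFC.log (b r))).re) (τ (c * b' s)).re s := by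
  have hbs := hpos.self_of_nhds
  set K : ℝ := ‖b s‖ + 1 with hKdef
  have hK : 0 < K := by positivity
  have hns := hbs.norm_one_sub_inv_smul_lt hK (by simp [hKdef])
  set h : ℝ → M := fun r => 1 - K⁻¹ • b r with hdef
  obtain ⟨ρ, hρ, hρ1⟩ := exists_between hns
  have hρ0 : 0 ≤ ρ := (norm_nonneg _).trans hρ.le
  have hhd : ∀ r, HasDerivAt h (-(K⁻¹ • b' r)) r := fun r => ((hb r).const_smul K⁻¹).const_sub 1
  have hhc : Continuous h := continuous_iff_continuousAt.2 fun r => (hhd r).continuousAt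
  set C : ℝ := ‖K⁻¹ • b' s‖ + 1 with hCdef
  obtain ⟨δ, hδ, hball⟩ := Metric.eventually_nhds_iff_ball.1
    (((hhc.norm.continuousAt (x := s)).eventually (gt_mem_nhds hρ)).and
      (((hb'.const_smul K⁻¹).norm.continuousAt (x := s)).eventually
        (gt_mem_nhds (show ‖K⁻¹ • b' s‖ < C by simp [hCdef]))))
  let g : ℕ → ℝ → ℂ := fun n r => τ (-((n + 1 : ℝ)⁻¹ • h r ^ (n + 1)))
  let g' : ℕ → ℝ → ℂ := fun n r => τ (h r ^ n * (K⁻¹ • b' r))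
  have hg : ∀ n r, r ∈ Metric.ball s δ → HasDerivAt (g n) (g' n r) r := fun n r _ => by
    have h1 := (((hhd r).fun_pow' (n + 1)).const_smul ((n + 1 : ℝ)⁻¹)).neg
    have h2 := (τ.restrictScalars ℝ).hasFDerivAt.comp_hasDerivAt r h1
    refine h2.congr_deriv ?_
    have h3 : ∀ i ∈ Finset.range (n + 1),
        τ (h r ^ ((n + 1).pred - i) * (K⁻¹ • b' r) * h r ^ i) = g' n r := fun i hi => by
      rw [hτtr, ← mul_assoc, ← pow_add]
      congr 3
      simp at hi ⊢
      omega
    have h4 : (n + 1 : ℂ) ≠ 0 := by exact_mod_cast n.succ_ne_zero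
    simp only [ContinuousLinearMap.coe_restrictScalars', mul_neg, neg_mul, Finset.sum_neg_distrib,
      smul_neg, neg_neg, ← Complex.coe_smul, map_smul, map_sum] at h3 ⊢
    rw [Finset.sum_congr rfl h3]
    simp [h4]
  have hu : Summable fun n : ℕ => ‖τ‖ * (ρ ^ n * C) :=
    ((summable_geometric_of_lt_one hρ0 hρ1).mul_right C |>.mul_left ‖τ‖)
  have hg' : ∀ n r, r ∈ Metric.ball s δ → ‖g' n r‖ ≤ ‖τ‖ * (ρ ^ n * C) := fun n r hr => by
    refine (τ.le_opNorm _).trans ?_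
    gcongr
    refine (norm_mul_le _ _).trans ?_
    have := hball r hr
    gcongr
    · exact (norm_pow_le _ _).trans (by gcongr; exact this.1.le)
    · exact this.2.le
  have hs := Metric.mem_ball_self hδ (x := s)
  have hsumt : ∀ r, ‖h r‖ < 1 → IsStrictlyPositive (b r) → HasSum (fun n => g n r)
      (τ (CFC.log (b r) - algebraMap ℝ M (Real.log K))) := fun r hr hr' =>
    (hr'.hasSum_log hK hr).mapL τ
  have hderiv := hasDerivAt_tsum_of_isPreconnected hu Metric.isOpen_ball
    (convex_ball s δ).isPreconnected hg hg' hs (hsumt s hns hbs).summable hs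
  have hval : ∑' n, g' n s = τ (c * b' s) := by
    have h1 := (((summable_geometric_of_norm_lt_one hns).hasSum.mul_right
      (K⁻¹ • b' s)).mapL τ).tsum_eq
    have h2 : K⁻¹ • (∑' n, h s ^ n) = c := by
      have h3 := geom_series_mul_neg (h s) hns
      have h4 : b s * c = 1 := by
        obtain ⟨u, hu⟩ := hbs.isUnit
        rw [← hu] at hc ⊢
        rw [show c = ↑u⁻¹ from Units.eq_inv_of_mul_eq_one_right hc]
        simp
      have h5 : 1 - h s = K⁻¹ • b s := by simp [hdef]
      rw [h5] at h3
      calc K⁻¹ • (∑' n, h s ^ n) = ((∑' n, h s ^ n) * (K⁻¹ • b s)) * c := by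
            rw [mul_smul_comm, smul_mul_assoc, mul_assoc, h4, mul_one]
        _ = c := by rw [h3, one_mul]
    rw [← h2]
    simpa [g'] using h1
  rw [hval] at hderiv
  have hre := (Complex.reCLM.hasFDerivAt.comp_hasDerivAt s hderiv).add_const
    ((τ (algebraMap ℝ M (Real.log K))).re)
  refine hre.congr_of_eventuallyEq ?_
  filter_upwards [hpos, Metric.ball_mem_nhds s hδ] with r hr hr'
  have := (hsumt r ((hball r hr').1.trans hρ1) hr).tsum_eq
  simp [this]

/-- Traces of logarithms of `a* a + δ` and `a a* + δ` agree. -/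
theorem trace_log_star_mul_self_add (τ : M →L[ℂ] ℂ) (hτtr : ∀ a b : M, τ (a * b) = τ (b * a))
    (a : M) {δ : ℝ} (hδ : 0 < δ) :
    τ (CFC.log (star a * a + δ • 1)) = τ (CFC.log (a * star a + δ • 1)) := by
  have hδ1 : IsStrictlyPositive (δ • 1 : M) := .smul hδ isStrictlyPositive_one
  have h1 : IsStrictlyPositive (star a * a + δ • 1) := .nonneg_add (star_mul_self_nonneg a) hδ1
  have h2 : IsStrictlyPositive (a * star a + δ • 1) := .nonneg_add (mul_star_self_nonneg a) hδ1
  set K : ℝ := ‖star a * a + δ • 1‖ + ‖a * star a + δ • 1‖ + 1 with hKdef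
  have hK : 0 < K := by positivity
  have hs1 := (h1.hasSum_log hK (h1.norm_one_sub_inv_smul_lt hK (by
    linarith [norm_nonneg (a * star a + δ • 1)]))).mapL τ
  have hs2 := (h2.hasSum_log hK (h2.norm_one_sub_inv_smul_lt hK (by
    linarith [norm_nonneg (star a * a + δ • 1)]))).mapL τ
  have hcomm : ∀ n : ℕ, (1 - K⁻¹ • (a * star a + δ • 1)) ^ n * a =
      a * (1 - K⁻¹ • (star a * a + δ • 1)) ^ n := fun n => by
    have h : SemiconjBy a (1 - K⁻¹ • (star a * a + δ • 1)) (1 - K⁻¹ • (a * star a + δ • 1)) := by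
      simp [SemiconjBy, mul_sub, sub_mul, mul_add, add_mul, mul_assoc]
    exact (h.pow_right n).symm
  have hpow : ∀ n : ℕ, τ ((1 - K⁻¹ • (star a * a + δ • 1)) ^ n) =
      τ ((1 - K⁻¹ • (a * star a + δ • 1)) ^ n) := fun n => by
    induction n with
    | zero => simp
    | succ n ih =>
      have e1 : (1 - K⁻¹ • (star a * a + δ • 1)) ^ (n + 1) =
          (1 - K⁻¹ * δ) • (1 - K⁻¹ • (star a * a + δ • 1)) ^ n -
          K⁻¹ • (star a * (a * (1 - K⁻¹ • (star a * a + δ • 1)) ^ n)) := by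
        rw [pow_succ']
        generalize (1 - K⁻¹ • (star a * a + δ • 1)) ^ n = P
        simp only [sub_mul, smul_add, add_mul, smul_smul, one_mul, smul_mul_assoc, sub_smul,
          one_smul, mul_assoc]
        abel
      have e2 : (1 - K⁻¹ • (a * star a + δ • 1)) ^ (n + 1) =
          (1 - K⁻¹ * δ) • (1 - K⁻¹ • (a * star a + δ • 1)) ^ n -
          K⁻¹ • ((1 - K⁻¹ • (a * star a + δ • 1)) ^ n * a * star a) := by
        rw [pow_succ]
        generalize (1 - K⁻¹ • (a * star a + δ • 1)) ^ n = P
        simp only [mul_sub, smul_add, mul_add, smul_smul, mul_one, mul_smul_comm, sub_smul,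
          one_smul, mul_assoc]
        abel
      rw [e1, e2, hcomm, map_sub, map_sub]
      simp only [← Complex.coe_smul, map_smul]
      simp only [Complex.coe_smul] at ih ⊢
      rw [ih, hτtr (star a)]
  have heq : ∀ n : ℕ, τ (-((n + 1 : ℝ)⁻¹ • (1 - K⁻¹ • (star a * a + δ • 1)) ^ (n + 1))) =
      τ (-((n + 1 : ℝ)⁻¹ • (1 - K⁻¹ • (a * star a + δ • 1)) ^ (n + 1))) := fun n => by
    have := hpow (n + 1)
    simp only [← Complex.coe_smul, map_smul, map_neg] at this ⊢
    rw [this]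
  simp_rw [heq] at hs1
  have := hs1.unique hs2
  simpa using this

/-- If `w` is a contraction whose powers have trace zero and `d` is invertible, the trace of the
logarithm of `|(d (1 + t w))*|²` does not depend on `t ∈ [0, 1)`. -/
theorem re_trace_log_perturb_eq [Nontrivial M] (τ : M →L[ℂ] ℂ)
    (hτtr : ∀ a b : M, τ (a * b) = τ (b * a)) (hτstar : ∀ a, τ (star a) = star (τ a))
    {d y w : M} (hyd : y * d = 1) (hdy : d * y = 1) (hw : ‖w‖ ≤ 1)
    (hτw : ∀ n : ℕ, τ (w ^ (n + 1)) = 0) {t : ℝ} (ht0 : 0 ≤ t) (ht1 : t < 1) :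
    IsStrictlyPositive (d * (1 + t • w) * star (d * (1 + t • w))) ∧
    (τ (CFC.log (d * (1 + t • w) * star (d * (1 + t • w))))).re =
      (τ (CFC.log (d * star d))).re := by
  let b : ℝ → M := fun s => d * (1 + s • w) * star (d * (1 + s • w))
  let b' : ℝ → M := fun s => d * w * star (d * (1 + s • w)) + d * (1 + s • w) * star (d * w)
  have hb : ∀ s, HasDerivAt b (b' s) s := fun s => by
    have h1 : HasDerivAt (fun s : ℝ => d * (1 + s • w)) (d * w) s := by
      simpa using (((hasDerivAt_id s).smul_const w).const_add 1).const_mul d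
    exact h1.mul h1.star
  have hb' : Continuous b' := by fun_prop
  have hpos : ∀ s : ℝ, |s| < 1 → IsStrictlyPositive (b s) := fun s hs => by
    obtain ⟨v, hv1, hv2, -⟩ := exists_inverse_one_add_smul τ hw hτw hs
    have hu : IsUnit (d * (1 + s • w)) :=
      (isUnit_iff_exists.2 ⟨y, hdy, hyd⟩).mul (isUnit_iff_exists.2 ⟨v, hv2, hv1⟩)
    exact (hu.mul hu.star).isStrictlyPositive (mul_star_self_nonneg _)
  have hderiv : ∀ s : ℝ, |s| < 1 → HasDerivAt (fun r => (τ (CFC.log (b r))).re) 0 s := by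
    intro s hs
    obtain ⟨v, hv1, hv2, hv3⟩ := exists_inverse_one_add_smul τ hw hτw hs
    have hev : ∀ᶠ r in 𝓝 s, IsStrictlyPositive (b r) := by
      filter_upwards [(continuous_abs.continuousAt (x := s)).eventually (gt_mem_nhds hs)]
        with r hr using hpos r hr
    set u := 1 + s • w with hu
    have hyd' : star d * star y = 1 := by rw [← star_mul, hyd, star_one]
    have hdy' : star y * star d = 1 := by rw [← star_mul, hdy, star_one]
    have hv1' : star u * star v = 1 := by rw [← star_mul, hv1, star_one]
    have hv2' : star v * star u = 1 := by rw [← star_mul, hv2, star_one]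
    have hc : star y * star v * (v * y) * b s = 1 := by
      calc star y * star v * (v * y) * (d * u * star (d * u))
          = star y * star v * (v * (y * d) * u) * (star u * star d) := by
            simp only [star_mul, mul_assoc]
        _ = star y * (star v * star u) * star d := by
            rw [hyd, mul_one, hv1, mul_one]; simp only [mul_assoc]
        _ = 1 := by rw [hv2', mul_one, hdy']
    refine (hasDerivAt_re_trace_log τ hτtr hb hb' hev hc).congr_deriv ?_
    have e1 : τ (star y * star v * (v * y) * (d * w * star (d * u))) = 0 := by
      have : star y * star v * (v * y) * (d * w * star (d * u)) =
          star y * star v * (v * w) * star u * star d := by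
        calc _ = star y * star v * (v * (y * d) * w) * star u * star d := by
              simp only [star_mul, mul_assoc]
          _ = _ := by rw [hyd, mul_one]
      rw [this, hτtr, show star d * (star y * star v * (v * w) * star u) =
        star d * star y * (star v * (v * w) * star u) by simp only [mul_assoc], hyd', one_mul,
        hτtr, ← mul_assoc, hv1', one_mul, hv3]
    have e2 : τ (star y * star v * (v * y) * (d * u * star (d * w))) = 0 := by
      have : star y * star v * (v * y) * (d * u * star (d * w)) =
          star y * star (w * v) * star d := by
        calc _ = star y * star v * (v * (y * d) * u) * star w * star d := by
              simp only [star_mul, mul_assoc]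
          _ = _ := by rw [hyd, mul_one, hv1, mul_one, star_mul]; simp only [mul_assoc]
      rw [this, hτtr, ← mul_assoc, hyd', one_mul, hτstar, hτtr, hv3, star_zero]
    change (τ (star y * star v * (v * y) * (d * w * star (d * u) + d * u * star (d * w)))).re = 0
    rw [mul_add, map_add, e1, e2, add_zero, Complex.zero_re]
  have habs : ∀ s ∈ Set.Icc 0 t, |s| < 1 := fun s hs =>
    abs_lt.2 ⟨by linarith [hs.1], hs.2.trans_lt ht1⟩
  refine ⟨hpos t (habs t ⟨ht0, le_rfl⟩), ?_⟩
  have := constant_of_has_deriv_right_zero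
    (fun s hs => (hderiv s (habs s hs)).continuousAt.continuousWithinAt)
    (fun s hs => (hderiv s (habs s ⟨hs.1, hs.2.le⟩)).hasDerivWithinAt) t ⟨ht0, le_rfl⟩
  simpa [b] using this

theorem one_add_mul_star_le {w : M} (hw : ‖w‖ ≤ 1) {t : ℝ} (ht0 : 0 ≤ t) (ht1 : t < 1) :
    (1 + w) * star (1 + w) ≤ (4 / (1 + t) ^ 2) • ((1 + t • w) * star (1 + t • w)) := by
  have hww : w * star w ≤ 1 := by
    refine CStarAlgebra.mul_star_le_algebraMap_norm_sq.trans ?_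
    rw [← map_one (algebraMap ℝ M)]
    exact algebraMap_mono M (by nlinarith [norm_nonneg w])
  have h1 : 0 ≤ ((1 - t) ^ 2 / (1 + t) ^ 2) • ((1 - w) * star (1 - w)) :=
    smul_nonneg (by positivity) (mul_star_self_nonneg _)
  have h2 : 0 ≤ ((2 - 2 * t ^ 2) / (1 + t) ^ 2) • (1 - w * star w) :=
    smul_nonneg (div_nonneg (by nlinarith) (by positivity)) (sub_nonneg.2 hww)
  rw [← sub_nonneg]
  refine (add_nonneg h1 h2).trans_eq ?_
  have ht : (1 + t) ≠ 0 := by positivity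
  simp only [star_add, star_sub, star_one, star_smul, star_trivial, mul_add, add_mul, mul_sub,
    sub_mul, one_mul, mul_one, smul_mul_assoc, mul_smul_comm]
  match_scalars <;> field_simp <;> ring

theorem cstarAbs_nonneg (a : M) : 0 ≤ cstarAbs a := CFC.sqrt_nonneg _

theorem cstarAbs_mul_self (a : M) : cstarAbs a * cstarAbs a = star a * a :=
  CFC.sqrt_mul_sqrt_self _ (star_mul_self_nonneg a)

theorem isStrictlyPositive_cstarAbs_add (a : M) {ε : ℝ} (hε : 0 < ε) :
    IsStrictlyPositive (cstarAbs a + ε • 1) :=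
  .nonneg_add (cstarAbs_nonneg a) (.smul hε isStrictlyPositive_one)

theorem sq_add_sq_le_cstarAbs_add_sq (a : M) {ε : ℝ} (hε : 0 < ε) :
    star a * a + ε ^ 2 • 1 ≤ (cstarAbs a + ε • 1) ^ 2 := by
  have h : 0 ≤ (2 * ε) • cstarAbs a := smul_nonneg (by positivity) (cstarAbs_nonneg a)
  rw [← sub_nonneg]
  refine h.trans_eq ?_
  rw [← cstarAbs_mul_self, sq]
  simp only [mul_add, add_mul, mul_one, one_mul, smul_mul_assoc, mul_smul_comm]
  match_scalars <;> ring

theorem cstarAbs_add_sq_le (a : M) {ε η : ℝ} (hε : 0 < ε) (hη : 0 < η) :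
    (cstarAbs a + ε • 1) ^ 2 ≤ (1 + ε / η) ^ 2 • (star a * a + η ^ 2 • 1) := by
  have hsa : IsSelfAdjoint (cstarAbs a) := (cstarAbs_nonneg a).isSelfAdjoint
  have h1 : 0 ≤ (ε / η) • ((cstarAbs a - η • 1) * star (cstarAbs a - η • 1)) :=
    smul_nonneg (by positivity) (mul_star_self_nonneg _)
  have h2 : 0 ≤ (ε / η + (ε / η) ^ 2) • (star a * a) :=
    smul_nonneg (by positivity) (star_mul_self_nonneg _)
  have h3 : 0 ≤ (η ^ 2 + ε * η) • (1 : M) := smul_nonneg (by positivity) zero_le_one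
  rw [← sub_nonneg]
  refine (add_nonneg (add_nonneg h1 h2) h3).trans_eq ?_
  rw [← cstarAbs_mul_self, sq (cstarAbs a + ε • 1)]
  simp only [star_sub, star_one, star_smul, star_trivial, hsa.star_eq, mul_add, add_mul, mul_sub,
    sub_mul, one_mul, mul_one, smul_mul_assoc, mul_smul_comm]
  match_scalars <;> field_simp <;> ring

theorem re_trace_log_mono (τ : M →L[ℂ] ℂ) (hτpos : ∀ a : M, 0 ≤ a → 0 ≤ τ a) {a b : M}
    (ha : IsStrictlyPositive a) (hab : a ≤ b) : (τ (CFC.log a)).re ≤ (τ (CFC.log b)).re := by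
  have := hτpos _ (sub_nonneg.2 (CFC.log_le_log hab ha))
  rw [map_sub, sub_nonneg] at this
  exact (Complex.le_def.1 this).1

theorem re_trace_log_smul (τ : M →L[ℂ] ℂ) (hτ1 : τ 1 = 1) {b : M} (hb : IsStrictlyPositive b)
    {r : ℝ} (hr : 0 < r) :
    (τ (CFC.log (r • b))).re = Real.log r + (τ (CFC.log b)).re := by
  rw [CFC.log_smul' b hr hb, map_add, Algebra.algebraMap_eq_smul_one, ← Complex.coe_smul, map_smul,
    hτ1]
  simp

theorem re_trace_log_sq (τ : M →L[ℂ] ℂ) {b : M} (hb : IsStrictlyPositive b) :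
    (τ (CFC.log (b ^ 2))).re = 2 * (τ (CFC.log b)).re := by
  rw [CFC.log_pow' 2 b hb, map_nsmul]
  simp

theorem fkDet_le_exp (τ : M →L[ℂ] ℂ) (a : M) {ε : ℝ} (hε : 0 < ε) :
    fkDet (τ : M →ₗ[ℂ] ℂ) a ≤ Real.exp (τ (CFC.log (cstarAbs a + ε • 1))).re :=
  ciInf_le (f := fun ε : {ε : ℝ // 0 < ε} => Real.exp (τ (CFC.log (cstarAbs a + (ε : ℝ) • 1))).re)
    ⟨0, by rintro _ ⟨ε, rfl⟩; positivity⟩ ⟨ε, hε⟩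

theorem exp_le_fkDet (τ : M →L[ℂ] ℂ) (hτpos : ∀ a : M, 0 ≤ a → 0 ≤ τ a)
    (hτtr : ∀ a b : M, τ (a * b) = τ (b * a)) {a : M} {l : ℝ}
    (h : ∀ δ : ℝ, 0 < δ → l ≤ (τ (CFC.log (a * star a + δ • 1))).re) :
    Real.exp (l / 2) ≤ fkDet (τ : M →ₗ[ℂ] ℂ) a := by
  have : Nonempty {ε : ℝ // 0 < ε} := ⟨⟨1, one_pos⟩⟩
  refine le_ciInf fun ⟨ε, hε⟩ => Real.exp_le_exp.2 ?_
  have h1 := h (ε ^ 2) (by positivity)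
  rw [← trace_log_star_mul_self_add τ hτtr a (by positivity : 0 < ε ^ 2)] at h1
  have h2 := re_trace_log_mono τ hτpos
    (.nonneg_add (star_mul_self_nonneg a) (.smul (by positivity) isStrictlyPositive_one))
    (sq_add_sq_le_cstarAbs_add_sq a hε)
  rw [re_trace_log_sq τ (isStrictlyPositive_cstarAbs_add a hε)] at h2
  change l / 2 ≤ (τ (CFC.log (cstarAbs a + ε • 1))).re
  linarith

theorem fkDet_le_of_mul_star_le [Nontrivial M] (τ : M →L[ℂ] ℂ) (hτ1 : τ 1 = 1)
    (hτpos : ∀ a : M, 0 ≤ a → 0 ≤ τ a) (hτtr : ∀ a b : M, τ (a * b) = τ (b * a)) {a b : M}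
    (hb : IsStrictlyPositive b) {C : ℝ} (hC : 0 < C) (hab : a * star a ≤ C • b) :
    fkDet (τ : M →ₗ[ℂ] ℂ) a ≤ Real.exp ((Real.log C + (τ (CFC.log b)).re) / 2) := by
  obtain ⟨m, hm, hmb⟩ := (CFC.exists_pos_algebraMap_le_iff hb.isSelfAdjoint).2
    fun x hx => hb.spectrum_pos hx
  have key : ∀ η : ℝ, 0 < η → fkDet (τ : M →ₗ[ℂ] ℂ) a ≤
      Real.exp ((Real.log ((1 + η) ^ 2) + (Real.log (C + η ^ 2 / m) + (τ (CFC.log b)).re)) / 2) := by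
    intro η hη
    have hη2 : 0 < η ^ 2 := by positivity
    refine (fkDet_le_exp τ a hη2).trans (Real.exp_le_exp.2 ?_)
    have hs1 : ∀ c : M, 0 ≤ c → IsStrictlyPositive (c + η ^ 2 • 1) := fun c hc =>
      .nonneg_add hc (.smul hη2 isStrictlyPositive_one)
    have hsq : (cstarAbs a + η ^ 2 • 1) ^ 2 ≤ (1 + η) ^ 2 • (star a * a + η ^ 2 • 1) := by
      have := cstarAbs_add_sq_le a hη2 hη
      rwa [sq η, mul_div_cancel_right₀ _ hη.ne', ← sq] at this
    have hpos := isStrictlyPositive_cstarAbs_add a hη2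
    have hpos2 : IsStrictlyPositive ((cstarAbs a + η ^ 2 • 1) ^ 2) :=
      (hpos.isUnit.pow 2).isStrictlyPositive (CStarAlgebra.pow_nonneg hpos.nonneg 2)
    have h1 := re_trace_log_mono τ hτpos hpos2 hsq
    rw [re_trace_log_sq τ hpos, re_trace_log_smul τ hτ1 (hs1 _ (star_mul_self_nonneg a))
      (by positivity), trace_log_star_mul_self_add τ hτtr a hη2] at h1
    have hle : a * star a + η ^ 2 • 1 ≤ (C + η ^ 2 / m) • b := by
      rw [add_smul]
      refine add_le_add hab ?_
      have := smul_le_smul_of_nonneg_left hmb (show 0 ≤ η ^ 2 / m by positivity)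
      rwa [Algebra.algebraMap_eq_smul_one, smul_smul, div_mul_cancel₀ _ hm.ne'] at this
    have h2 := re_trace_log_mono τ hτpos (hs1 _ (mul_star_self_nonneg a)) hle
    rw [re_trace_log_smul τ hτ1 hb (by positivity)] at h2
    linarith
  have hlim : Tendsto (fun η : ℝ => Real.exp ((Real.log ((1 + η) ^ 2) +
      (Real.log (C + η ^ 2 / m) + (τ (CFC.log b)).re)) / 2)) (𝓝[>] 0)
      (𝓝 (Real.exp ((Real.log C + (τ (CFC.log b)).re) / 2))) := by
    have : ContinuousAt (fun η : ℝ => Real.exp ((Real.log ((1 + η) ^ 2) +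
      (Real.log (C + η ^ 2 / m) + (τ (CFC.log b)).re)) / 2)) 0 := by
      fun_prop (disch := simp [hC.ne'])
    simpa using this.tendsto.mono_left nhdsWithin_le_nhds
  exact ge_of_tendsto hlim (eventually_nhdsWithin_of_forall key)

theorem fkDet_mul_one_add_eq [Nontrivial M] (τ : M →L[ℂ] ℂ) (hτ1 : τ 1 = 1)
    (hτpos : ∀ a : M, 0 ≤ a → 0 ≤ τ a) (hτtr : ∀ a b : M, τ (a * b) = τ (b * a))
    (hτstar : ∀ a, τ (star a) = star (τ a)) {d y w : M} (hyd : y * d = 1) (hdy : d * y = 1)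
    (hw : ‖w‖ ≤ 1) (hτw : ∀ n : ℕ, τ (w ^ (n + 1)) = 0) :
    fkDet (τ : M →ₗ[ℂ] ℂ) (d * (1 + w)) = fkDet (τ : M →ₗ[ℂ] ℂ) d := by
  have hd : IsUnit d := isUnit_iff_exists.2 ⟨y, hdy, hyd⟩
  have hdd : IsStrictlyPositive (d * star d) :=
    (hd.mul hd.star).isStrictlyPositive (mul_star_self_nonneg _)
  set l := (τ (CFC.log (d * star d))).re with hl
  have hpert := fun (t : ℝ) (h0 : 0 ≤ t) (h1 : t < 1) =>
    re_trace_log_perturb_eq τ hτtr hτstar hyd hdy hw hτw h0 h1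
  have hd_eq : fkDet (τ : M →ₗ[ℂ] ℂ) d = Real.exp (l / 2) := by
    refine le_antisymm ?_ (exp_le_fkDet τ hτpos hτtr fun δ hδ => ?_)
    · simpa using fkDet_le_of_mul_star_le τ hτ1 hτpos hτtr hdd one_pos (one_smul ℝ (d * star d)).ge
    · exact re_trace_log_mono τ hτpos hdd
        (le_add_of_nonneg_right (smul_nonneg hδ.le zero_le_one))
  rw [hd_eq]
  have hIoo : Set.Ioo (0 : ℝ) 1 ∈ 𝓝[<] (1 : ℝ) := Ioo_mem_nhdsLT one_pos
  refine le_antisymm ?_ (exp_le_fkDet τ hτpos hτtr fun δ hδ => ?_)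
  · have hlim : Tendsto (fun t : ℝ => Real.exp ((Real.log (4 / (1 + t) ^ 2) + l) / 2)) (𝓝[<] 1)
        (𝓝 (Real.exp (l / 2))) := by
      have : ContinuousAt (fun t : ℝ => Real.exp ((Real.log (4 / (1 + t) ^ 2) + l) / 2)) 1 := by
        fun_prop (disch := norm_num)
      have h := this.tendsto.mono_left (nhdsWithin_le_nhds (s := Set.Iio 1))
      norm_num at h
      exact h
    refine ge_of_tendsto hlim ?_
    filter_upwards [hIoo] with t ht
    obtain ⟨hp, hq⟩ := hpert t ht.1.le ht.2
    rw [hl, ← hq]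
    refine fkDet_le_of_mul_star_le τ hτ1 hτpos hτtr hp (by have := ht.1; positivity) ?_
    have := star_right_conjugate_le_conjugate (one_add_mul_star_le hw ht.1.le ht.2) d
    simpa only [star_mul, mul_smul_comm, smul_mul_assoc, mul_assoc] using this
  · have hcont : Continuous fun t : ℝ => ‖d * (1 + t • w) * star (d * (1 + t • w)) -
        d * (1 + w) * star (d * (1 + w))‖ := by fun_prop
    have hev := (hcont.tendsto 1).eventually_lt_const (show _ < δ by simpa using hδ)
    obtain ⟨t, htδ, ht⟩ := ((hev.filter_mono (nhdsWithin_le_nhds (s := Set.Iio 1))).and hIoo).exists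
    obtain ⟨hp, hq⟩ := hpert t ht.1.le ht.2
    rw [hl, ← hq]
    refine re_trace_log_mono τ hτpos hp ?_
    rw [← sub_le_iff_le_add']
    refine (IsSelfAdjoint.le_algebraMap_norm_self ?_).trans ?_
    · exact (IsSelfAdjoint.mul_star_self _).sub (IsSelfAdjoint.mul_star_self _)
    · rw [← Algebra.algebraMap_eq_smul_one]
      exact algebraMap_mono M htδ.le

end FugledeKadison

/-- Let `M` be a unital C*-algebra with a tracial state `τ`, `D` a C*-subalgebra
of `M` containing the unit, `A` a unital subalgebra of `M` containing `D`, and `Φ : A → D` a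
unital algebra homomorphism restricting to the identity on `D` and preserving `τ`. If `x ∈ A`
is such that `Φ(x)` is invertible in `D` (with inverse `y ∈ D`) and `‖Φ(x)⁻¹ x − 1‖ ≤ 1`,
then `Δ_τ(Φ(x)) = Δ_τ(x)`. -/
theorem fkDet_of_invertible_image
    {M : Type*} [CStarAlgebra M] [PartialOrder M] [StarOrderedRing M]
    (τ : M →ₗ[ℂ] ℂ)
    (hτ1 : τ 1 = 1)
    (hτpos : ∀ a : M, 0 ≤ a → 0 ≤ τ a)
    (hτtr : ∀ a b : M, τ (a * b) = τ (b * a))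
    (D A : Subalgebra ℂ M)
    (hDstar : ∀ d ∈ D, star d ∈ D)
    (hDclosed : IsClosed (D : Set M))
    (hDA : D ≤ A)
    (Φ : ↥A →ₐ[ℂ] M)
    (hΦD : ∀ a : ↥A, Φ a ∈ D)
    (hΦid : ∀ d : M, ∀ hd : d ∈ D, Φ ⟨d, hDA hd⟩ = d)
    (hΦτ : ∀ a : ↥A, τ (Φ a) = τ (a : M)) :
    ∀ x : ↥A, ∀ y : M, y ∈ D → y * Φ x = 1 → Φ x * y = 1 →
      ‖y * (x : M) - 1‖ ≤ 1 → fkDet τ (Φ x) = fkDet τ (x : M) := by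
  intro x y hy hyx hxy hnorm
  have : Nontrivial M := ⟨⟨1, 0, fun h => by simp [h] at hτ1⟩⟩
  let τp : M →ₚ[ℂ] ℂ := .mk₀ τ hτpos
  let τc : M →L[ℂ] ℂ := ⟨τ, map_continuous τp⟩
  have hτstar : ∀ a, τc (star a) = star (τc a) := fun a => map_star τp a
  let w : A := ⟨y, hDA hy⟩ * x - 1
  have hΦw : Φ w = 0 := by simp [w, hΦid y hy, hyx]
  have hτw : ∀ n : ℕ, τc ((w : M) ^ (n + 1)) = 0 := fun n => by
    have := hΦτ (w ^ (n + 1))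
    rw [map_pow, hΦw, zero_pow n.succ_ne_zero, map_zero] at this
    exact this.symm
  have hx : Φ x * (1 + (w : M)) = x := by
    simp [w, ← mul_assoc, hxy]
  have := fkDet_mul_one_add_eq τc hτ1 hτpos hτtr hτstar hyx hxy hnorm hτw
  change fkDet τ (Φ x * (1 + (w : M))) = fkDet τ (Φ x) at this
  rw [← this, hx]
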